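/- Let Ω ⊂ ℂⁿ be a smoothly bounded strongly convex domain and φ = (φ₁,...,φₙ) a holomorphic self-map of Ω whose components extend holomorphically to a neighborhood of the closure of Ω. If C_φ is compact on A²(Ω) and p ∈ ∂Ω ∩ ∂(φ(closure Ω)), then the Jacobian determinant J_φ(p) = 0. -/

import Mathlib

open MeasureTheory Metric Filter Set Topology

noncomputable section

/-- `ℂⁿ` with its Euclidean metric. -/
abbrev Cn (n : ℕ) := EuclideanSpace ℂ (Fin n)

instance (n : ℕ) : MeasurableSpace (Cn n) := borel _
instance (n : ℕ) : BorelSpace (Cn n) := ⟨rfl⟩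

/-- Membership in the Bergman space `A²(Ω)`. -/
def InA2 {n : ℕ} (Ω : Set (Cn n)) (f : Cn n → ℂ) : Prop :=
  DifferentiableOn ℂ f Ω ∧ IntegrableOn (fun z => ‖f z‖ ^ 2) Ω volume

/-- The `A²` inner product `⟨f, g⟩ = ∫_Ω f ḡ dV`. -/
def a2Inner {n : ℕ} (Ω : Set (Cn n)) (f g : Cn n → ℂ) : ℂ :=
  ∫ z in Ω, (starRingEnd ℂ) (g z) * f z

/-- The squared `A²(Ω)` norm. -/
def a2NormSq {n : ℕ} (Ω : Set (Cn n)) (f : Cn n → ℂ) : ℝ :=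
  ∫ z in Ω, ‖f z‖ ^ 2

/-- A sequence in `A²(Ω)` converging weakly to `0`. -/
def WeakNull {n : ℕ} (Ω : Set (Cn n)) (g : ℕ → Cn n → ℂ) : Prop :=
  (∀ j, InA2 Ω (g j)) ∧
  ∀ f, InA2 Ω f → Tendsto (fun j => a2Inner Ω (g j) f) atTop (nhds 0)

/-- Compactness of the composition operator `C_φ` on `A²(Ω)`:
`C_φ` maps weakly null sequences to norm-null sequences. -/
def CompactCompOp {n : ℕ} (Ω : Set (Cn n)) (φ : Cn n → Cn n) : Prop :=
  ∀ g : ℕ → Cn n → ℂ, WeakNull Ω g →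
    Tendsto (fun j => a2NormSq Ω (fun z => g j (φ z))) atTop (nhds 0)

/-- The open unit disc in `ℂ`. -/
def uDisc : Set ℂ := Metric.ball 0 1

/-- `Δ` is a non-trivial analytic disc contained in `S`. -/
def IsNontrivialDiscIn {n : ℕ} (S : Set (Cn n)) (Δ : Set (Cn n)) : Prop :=
  ∃ F : ℂ → Cn n, DifferentiableOn ℂ F uDisc ∧ (¬ ∃ c, Set.EqOn F (fun _ => c) uDisc) ∧
    F '' uDisc = Δ ∧ Δ ⊆ S

/-- `𝓛`: the union of all non-trivial analytic discs in `∂Ω`. -/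
def discUnion {n : ℕ} (Ω : Set (Cn n)) : Set (Cn n) :=
  {p | ∃ Δ, IsNontrivialDiscIn (frontier Ω) Δ ∧ p ∈ Δ}

/-- The limit point disc condition. -/
def LimitPointDiscCond {n : ℕ} (Ω : Set (Cn n)) : Prop :=
  ∀ p ∈ closure (discUnion Ω), ∃ Δ, IsNontrivialDiscIn (frontier Ω) Δ ∧ p ∈ closure Δ

/-- A `C^k` defining function for `Ω`. -/
def IsDefiningFn {n : ℕ} (Ω : Set (Cn n)) (k : ℕ∞) (ρ : Cn n → ℝ) : Prop :=
  ContDiff ℝ k ρ ∧ Ω = {z | ρ z < 0} ∧ frontier Ω = {z | ρ z = 0} ∧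
    ∀ p ∈ frontier Ω, fderiv ℝ ρ p ≠ 0

/-- Wirtinger derivative `∂f/∂z_j` at `p`. -/
def wD {n : ℕ} (f : Cn n → ℂ) (p : Cn n) (j : Fin n) : ℂ :=
  (fderiv ℝ f p (EuclideanSpace.single j 1)
    - Complex.I * fderiv ℝ f p (EuclideanSpace.single j Complex.I)) / 2

/-- Wirtinger derivative `∂f/∂z̄_j` at `p`. -/
def wDbar {n : ℕ} (f : Cn n → ℂ) (p : Cn n) (j : Fin n) : ℂ :=
  (fderiv ℝ f p (EuclideanSpace.single j 1)
    + Complex.I * fderiv ℝ f p (EuclideanSpace.single j Complex.I)) / 2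

/-- The Levi form `∑_{j,k} ∂²ρ/∂z_j∂z̄_k (p) v_j w̄_k`. -/
def leviForm {n : ℕ} (ρ : Cn n → ℝ) (p : Cn n) (v w : Cn n) : ℂ :=
  ∑ j, ∑ k, wD (fun q => wDbar (fun z => ((ρ z : ℝ) : ℂ)) q k) p j * v j * (starRingEnd ℂ) (w k)

/-- `p` is a Levi-flat boundary point: the Levi form restricted to the complex tangent
space at `p` has a zero eigenvalue. -/
def LeviFlatPt {n : ℕ} (ρ : Cn n → ℝ) (p : Cn n) : Prop :=
  ∃ v : Cn n, v ≠ 0 ∧ (∑ j, wD (fun z => ((ρ z : ℝ) : ℂ)) p j * v j = 0) ∧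
    leviForm ρ p v v = 0

/-- Plurisubharmonicity on `Ω` (sub-mean value property on complex discs). -/
def PlurisubharmonicOn {n : ℕ} (u : Cn n → ℝ) (Ω : Set (Cn n)) : Prop :=
  UpperSemicontinuousOn u Ω ∧ ∀ a b : Cn n, ∀ r : ℝ, 0 < r →
    (∀ t : ℂ, ‖t‖ ≤ r → a + t • b ∈ Ω) →
    u a ≤ (1 / (2 * Real.pi)) *
      ∫ θ in (0:ℝ)..(2 * Real.pi), u (a + ((r * Complex.exp (θ * Complex.I)) • b))

/-- Hartogs pseudoconvexity: `-log d(·, Ωᶜ)` is plurisubharmonic on `Ω`. -/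
def IsPseudoconvex {n : ℕ} (Ω : Set (Cn n)) : Prop :=
  IsOpen Ω ∧ PlurisubharmonicOn (fun z => -Real.log (Metric.infDist z Ωᶜ)) Ω

/-- The complex Jacobian determinant of `φ` at `p`. -/
def Jdet {n : ℕ} (φ : Cn n → Cn n) (p : Cn n) : ℂ :=
  LinearMap.det (fderiv ℂ φ p).toLinearMap

/-- The unit polydisc in `ℂⁿ`. -/
def polydisc (n : ℕ) : Set (Cn n) := {z | ∀ i, ‖z i‖ < 1}

/-- Second-order Taylor expansion at a point, with a little-o remainder. -/
lemma ContDiff.second_order_bound {E : Type*} [NormedAddCommGroup E] [NormedSpace ℝ E]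
    {f : E → ℝ} (hf : ContDiff ℝ 2 f) (p : E) {ε : ℝ} (hε : 0 < ε) :
    ∃ r > 0, ∀ h : E, ‖h‖ < r →
      |f (p + h) - f p - fderiv ℝ f p h - fderiv ℝ (fderiv ℝ f) p h h / 2| ≤ ε * ‖h‖ ^ 2 := by
  have hd : Differentiable ℝ f := hf.differentiable (by norm_num)
  have hd2 : Differentiable ℝ (fderiv ℝ f) :=
    (hf.fderiv_right (m := 1) (by norm_num)).differentiable (by norm_num)
  have hlo := (hasFDerivAt_iff_isLittleO_nhds_zero.1 (hd2 p).hasFDerivAt).def hε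
  obtain ⟨r, hr, hball⟩ := Metric.eventually_nhds_iff.1 hlo
  refine ⟨r, hr, fun h hh => ?_⟩
  have hderiv : ∀ t : ℝ, HasDerivAt
      (fun t : ℝ => f (p + t • h) - t * fderiv ℝ f p h - t ^ 2 * (fderiv ℝ (fderiv ℝ f) p h h / 2))
      (fderiv ℝ f (p + t • h) h - fderiv ℝ f p h - t * fderiv ℝ (fderiv ℝ f) p h h) t := by
    intro t
    have h1 : HasDerivAt (fun t : ℝ => p + t • h) h t := by
      simpa using ((hasDerivAt_id t).smul_const h).const_add p
    have h2 := (hd (p + t • h)).hasFDerivAt.comp_hasDerivAt t h1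
    have h3 := (hasDerivAt_id t).mul_const (fderiv ℝ f p h)
    have h4 := ((hasDerivAt_id t).pow 2).mul_const (fderiv ℝ (fderiv ℝ f) p h h / 2)
    exact ((h2.sub h3).sub h4).congr_deriv (by simp; ring)
  have key := Convex.norm_image_sub_le_of_norm_hasDerivWithin_le (C := ε * ‖h‖ ^ 2)
    (s := Icc (0 : ℝ) 1) (fun t _ => (hderiv t).hasDerivWithinAt) ?_ (convex_Icc 0 1)
    (x := 0) (y := 1) (by simp) (by simp)
  · convert key using 1
    · rw [Real.norm_eq_abs]
      congr 1
      simp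
      ring
    · simp
  · intro t ht
    have hth : ‖t • h‖ ≤ ‖h‖ := by
      rw [norm_smul, Real.norm_eq_abs, abs_of_nonneg ht.1]
      exact mul_le_of_le_one_left (norm_nonneg _) ht.2
    have h5 := hball (y := t • h) (by simpa using hth.trans_lt hh)
    have h6 := ContinuousLinearMap.le_opNorm
      (fderiv ℝ f (p + t • h) - fderiv ℝ f p - fderiv ℝ (fderiv ℝ f) p (t • h)) h
    have h7 : fderiv ℝ f (p + t • h) h - fderiv ℝ f p h - t * fderiv ℝ (fderiv ℝ f) p h h =
        (fderiv ℝ f (p + t • h) - fderiv ℝ f p - fderiv ℝ (fderiv ℝ f) p (t • h)) h := by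
      simp
    rw [h7]
    refine h6.trans ?_
    calc _ ≤ (ε * ‖h‖) * ‖h‖ := by
          gcongr
          exact h5.trans (by gcongr)
      _ = _ := by ring

/-- A quadratic form that is positive on the kernel of a functional `D` becomes positive definite
after adding a large multiple of `D²`. -/
lemma exists_pos_le_add_mul_sq {E : Type*} [NormedAddCommGroup E] [NormedSpace ℝ E]
    [FiniteDimensional ℝ E] (H : E →L[ℝ] E →L[ℝ] ℝ) (D : E →L[ℝ] ℝ)
    (hpos : ∀ v, v ≠ 0 → D v = 0 → 0 < H v v) :
    ∃ c > 0, ∃ C ≥ 0, ∀ v, c * ‖v‖ ^ 2 ≤ H v v + C * (D v) ^ 2 := by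
  have hK : IsCompact (sphere (0 : E) 1) := isCompact_sphere 0 1
  obtain ⟨m, hm⟩ : ∃ m : ℕ, sphere (0 : E) 1 ⊆ {v | 0 < H v v + m * (D v) ^ 2} := by
    refine hK.elim_directed_cover _ (fun m => isOpen_lt continuous_const (by fun_prop)) ?_ ?_
    · intro v hv
      rw [mem_iUnion]
      by_cases hDv : D v = 0
      · refine ⟨0, ?_⟩
        have : v ≠ 0 := by rintro rfl; simp at hv
        simpa [hDv] using hpos v this hDv
      · obtain ⟨m, hm⟩ := exists_nat_gt (-(H v v) / (D v) ^ 2)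
        refine ⟨m, ?_⟩
        have : 0 < (D v) ^ 2 := by positivity
        rw [div_lt_iff₀ this] at hm
        simp only [mem_ofPred_eq]
        linarith
    · refine directed_of_isDirected_le fun a b hab v hv => ?_
      simp only [mem_ofPred_eq] at hv ⊢
      have : (a : ℝ) ≤ b := by exact_mod_cast hab
      nlinarith [sq_nonneg (D v)]
  obtain ⟨c, hc, hcK⟩ := hK.exists_forall_le' (f := fun v => H v v + m * (D v) ^ 2) (a := 0)
    (by fun_prop) hm
  refine ⟨c, hc, m, by positivity, fun v => ?_⟩
  rcases eq_or_ne v 0 with rfl | hv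
  · simp
  have hn : 0 < ‖v‖ := norm_pos_iff.2 hv
  have := hcK (‖v‖⁻¹ • v) (by simp [norm_smul, hn.ne'])
  simp only [map_smul, smul_apply, smul_eq_mul] at this
  have h2 : ‖v‖⁻¹ * (‖v‖⁻¹ * H v v) + m * (‖v‖⁻¹ * D v) ^ 2 =
      (H v v + m * (D v) ^ 2) / ‖v‖ ^ 2 := by field_simp
  rwa [h2, le_div_iff₀ (by positivity)] at this

/-- A convex open set is quadratically separated from its tangent hyperplane at a boundary point
where the defining function has positive definite tangential Hessian. -/
lemma Convex.exists_quadratic_support {E : Type*} [NormedAddCommGroup E] [NormedSpace ℝ E]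
    [FiniteDimensional ℝ E] {Ω : Set E} (hΩo : IsOpen Ω) (hΩc : Convex ℝ Ω)
    (hΩb : Bornology.IsBounded Ω) {ρ : E → ℝ} (hρ : ContDiff ℝ 2 ρ) (hneg : ∀ z ∈ Ω, ρ z < 0)
    {p : E} (hp : p ∈ closure Ω) (hp0 : ρ p = 0)
    (hpos : ∀ v, v ≠ 0 → fderiv ℝ ρ p v = 0 → 0 < fderiv ℝ (fderiv ℝ ρ) p v v) :
    ∃ k > 0, ∀ w ∈ Ω, k * ‖w - p‖ ^ 2 ≤ -fderiv ℝ ρ p (w - p) := by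
  obtain ⟨c, hc, C, hC, hcC⟩ := exists_pos_le_add_mul_sq _ _ hpos
  set D := fderiv ℝ ρ p with hD
  obtain ⟨r, hr, htay⟩ := hρ.second_order_bound p (ε := c / 4) (by positivity)
  have hseg : ∀ w ∈ Ω, ∀ t : ℝ, 0 < t → t ≤ 1 → p + t • (w - p) ∈ Ω := by
    intro w hw t ht ht1
    have := hΩc.combo_closure_interior_mem_interior hp (by rwa [hΩo.interior_eq])
      (a := 1 - t) (b := t) (by linarith) ht (by ring)
    rw [hΩo.interior_eq] at this
    convert this using 1
    module
  have hD0 : ∀ w ∈ Ω, D (w - p) ≤ 0 := by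
    intro w hw
    have h1 : HasDerivAt (fun t : ℝ => p + t • (w - p)) (w - p) 0 := by
      simpa using ((hasDerivAt_id (0 : ℝ)).smul_const (w - p)).const_add p
    have h2 : HasDerivAt (fun t : ℝ => ρ (p + t • (w - p))) (D (w - p)) 0 := by
      have h3 : HasFDerivAt ρ D (p + (0 : ℝ) • (w - p)) := by
        simpa using (hρ.differentiable (by norm_num) p).hasFDerivAt
      exact h3.comp_hasDerivAt 0 h1
    have h3 := h2.tendsto_slope_zero_right
    refine le_of_tendsto h3 ?_
    filter_upwards [Ioc_mem_nhdsGT (zero_lt_one' ℝ)] with t ht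
    have h4 := (hneg _ (hseg w hw t ht.1 ht.2)).le
    simp only [zero_add, zero_smul, add_zero, hp0, sub_zero, smul_eq_mul]
    exact mul_nonpos_of_nonneg_of_nonpos (inv_nonneg.2 ht.1.le) h4
  obtain ⟨R, hR⟩ := hΩb.exists_norm_le
  set B := R + ‖p‖ + 1 with hB
  have hBpos : ∀ w ∈ Ω, ‖w - p‖ < B := fun w hw => by
    linarith [norm_sub_le w p, hR w hw]
  rcases Ω.eq_empty_or_nonempty with rfl | ⟨w₀, hw₀⟩
  · exact ⟨1, one_pos, by simp⟩
  have hB0 : 0 < B := (norm_nonneg _).trans_lt (hBpos w₀ hw₀)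
  set A := 1 + C * (‖D‖ * B) with hA
  have hA1 : 1 ≤ A := by
    have : 0 ≤ C * (‖D‖ * B) := by positivity
    linarith
  set t := min 1 (r / B) with ht
  have ht0 : 0 < t := lt_min one_pos (by positivity)
  refine ⟨c / 4 * t / A, by positivity, fun w hw => ?_⟩
  have hmem := hneg _ (hseg w hw t ht0 (min_le_left _ _))
  have hnorm : ‖t • (w - p)‖ < r := by
    rw [norm_smul, Real.norm_eq_abs, abs_of_pos ht0]
    calc t * ‖w - p‖ < t * B := by gcongr; exact hBpos w hw
      _ ≤ r / B * B := by gcongr; exact min_le_right _ _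
      _ = r := by field_simp
  have h1 := (abs_le.1 (htay _ hnorm)).1
  have h2 := hcC (t • (w - p))
  simp only [map_smul, smul_apply, smul_eq_mul, norm_smul, Real.norm_eq_abs,
    abs_of_pos ht0, hp0, ← hD] at h1 h2
  have h3 := hD0 w hw
  have h4 : |D (w - p)| ≤ ‖D‖ * B := (D.le_opNorm _).trans (by gcongr; exact (hBpos w hw).le)
  rw [abs_of_nonpos h3] at h4
  set x := -D (w - p) with hx
  have hDx : D (w - p) = -x := by simp [hx]
  rw [hDx] at h1 h2
  have hx0 : 0 ≤ x := by linarith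
  have hN := sq_nonneg ‖w - p‖
  have h5 : c / 4 * t ^ 2 * ‖w - p‖ ^ 2 ≤ t * x + C / 2 * t ^ 2 * x ^ 2 := by nlinarith
  have h6 : x ^ 2 ≤ ‖D‖ * B * x := by nlinarith
  have h7 : C / 2 * t ^ 2 * x ^ 2 ≤ C * t * (‖D‖ * B * x) := by
    have ht1 : t ≤ 1 := min_le_left _ _
    have : t ^ 2 ≤ t := by nlinarith
    calc C / 2 * t ^ 2 * x ^ 2 ≤ C * t ^ 2 * x ^ 2 := by gcongr; linarith
      _ ≤ C * t * (‖D‖ * B * x) := by gcongr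
  have h8 : t * (c / 4 * t * ‖w - p‖ ^ 2) ≤ t * (A * x) := by
    rw [hA]; nlinarith
  have h9 := le_of_mul_le_mul_left h8 ht0
  rw [div_mul_eq_mul_div, div_le_iff₀ (by positivity)]
  linarith

/-- Second-order remainder bound for holomorphic functions of several variables. -/
lemma DifferentiableOn.exists_quadratic_remainder {E F : Type*} [NormedAddCommGroup E]
    [NormedSpace ℂ E] [NormedAddCommGroup F] [NormedSpace ℂ F] {f : E → F} {U : Set E}
    (hf : DifferentiableOn ℂ f U) {q : E} (hU : U ∈ 𝓝 q) :
    ∃ M ≥ 0, ∃ r > 0, ∀ h, ‖h‖ < r →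
      ‖f (q + h) - f q - fderiv ℂ f q h‖ ≤ M * ‖h‖ ^ 2 := by
  have hq : DifferentiableAt ℂ f q := hf.differentiableAt hU
  set g : E → F := fun z => f z - f q - fderiv ℂ f q (z - q) with hg
  have hgq : g q = 0 := by simp [hg]
  have hgc : ContinuousAt g q := by
    have := hq.continuousAt
    fun_prop
  have h1 : ∀ᶠ z in 𝓝 q, z ∈ U ∧ g z ∈ closedBall (g q) 1 :=
    Filter.Eventually.and hU (hgc (closedBall_mem_nhds _ one_pos))
  obtain ⟨r, hr, hball⟩ := Metric.eventually_nhds_iff_ball.1 h1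
  refine ⟨1 / r ^ 2, by positivity, r, hr, fun h hh => ?_⟩
  have hgd : DifferentiableOn ℂ g (ball q r) := by
    have : DifferentiableOn ℂ f (ball q r) := hf.mono fun z hz => (hball z hz).1
    fun_prop
  have hlo : (g · - g q) =o[𝓝 q] (fun w ↦ ‖w - q‖ ^ 1) := by
    simp only [hgq, sub_zero, pow_one]
    exact hq.hasFDerivAt.isLittleO.norm_right
  have key := Complex.dist_le_mul_div_pow_of_mapsTo_ball_of_isLittleO (z := q + h) hgd
    (fun z hz => (hball z hz).2) hlo (by simpa using hh)
  rw [hgq, dist_zero_right] at key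
  simp only [hg, add_sub_cancel_left, dist_self_add_left] at key
  convert key using 1
  ring

/-- A nonzero real functional on a complex Hilbert space is a negative multiple of the real part of
the inner product with a unit vector. -/
lemma exists_unit_eq_neg_re_inner {E : Type*} [NormedAddCommGroup E] [InnerProductSpace ℂ E]
    [CompleteSpace E] [NormedSpace ℝ E] [IsScalarTower ℝ ℂ E] (D : E →L[ℝ] ℝ) (hD : D ≠ 0) :
    ∃ u : E, ‖u‖ = 1 ∧ ∃ a > 0, ∀ h, D h = -(a * (inner ℂ u h).re) := by
  set N : StrongDual ℂ E := StrongDual.extendRCLike (𝕜 := ℂ) D with hN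
  set ν := (InnerProductSpace.toDual ℂ E).symm N with hν
  have hNν : ∀ h, (inner ℂ ν h).re = D h := by
    intro h
    rw [hν, InnerProductSpace.toDual_symm_apply]
    exact StrongDual.re_extendRCLike_apply (𝕜 := ℂ) D h
  have hν0 : ν ≠ 0 := by
    intro h0
    refine hD (ContinuousLinearMap.ext fun h => ?_)
    rw [← hNν h, h0]
    simp
  have hpos : 0 < ‖ν‖ := norm_pos_iff.2 hν0
  refine ⟨-((‖ν‖⁻¹ : ℝ) : ℂ) • ν, by simp [norm_smul, hpos.ne'], ‖ν‖, hpos, fun h => ?_⟩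
  rw [inner_smul_left, ← hNν h]
  simp only [map_neg, Complex.conj_ofReal, neg_mul, Complex.neg_re, Complex.re_ofReal_mul]
  field_simp

/-- The anisotropic dilation by `t ^ 2` along the complex line of the unit vector `u` and by `t`
along its orthogonal complement. -/
def anisoDil {n : ℕ} (u : Cn n) (t : ℝ) : Cn n →L[ℂ] Cn n :=
  (t : ℂ) • ContinuousLinearMap.id ℂ (Cn n) +
    ((t : ℂ) ^ 2 - t) • (innerSL ℂ u).smulRight u

lemma anisoDil_apply {n : ℕ} (u : Cn n) (t : ℝ) (y : Cn n) :
    anisoDil u t y = (t : ℂ) • y + ((t : ℂ) ^ 2 - t) • inner ℂ u y • u := by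
  simp [anisoDil]

lemma anisoDil_eq {n : ℕ} (u : Cn n) (t : ℝ) (y : Cn n) :
    anisoDil u t y = (t : ℂ) • (y - inner ℂ u y • u) + ((t : ℂ) ^ 2 * inner ℂ u y) • u := by
  rw [anisoDil_apply]
  module

lemma inner_self_of_unit {n : ℕ} {u : Cn n} (hu : ‖u‖ = 1) : inner ℂ u u = 1 := by
  rw [inner_self_eq_norm_sq_to_K, hu]
  simp

lemma inner_anisoDil {n : ℕ} {u : Cn n} (hu : ‖u‖ = 1) (t : ℝ) (y : Cn n) :
    inner ℂ u (anisoDil u t y) = (t : ℂ) ^ 2 * inner ℂ u y := by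
  rw [anisoDil_apply, inner_add_right, inner_smul_right, inner_smul_right, inner_smul_right,
    inner_self_of_unit hu]
  ring

lemma inner_sub_proj {n : ℕ} {u : Cn n} (hu : ‖u‖ = 1) (y : Cn n) :
    inner ℂ u (y - inner ℂ u y • u) = 0 := by
  rw [inner_sub_right, inner_smul_right, inner_self_of_unit hu, mul_one, sub_self]

lemma norm_sq_add_smul {n : ℕ} {u z : Cn n} (hu : ‖u‖ = 1) (hz : inner ℂ u z = 0) (b : ℂ) :
    ‖z + b • u‖ ^ 2 = ‖z‖ ^ 2 + ‖b‖ ^ 2 := by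
  have h : inner ℂ z (b • u) = 0 := by
    rw [inner_smul_right, inner_eq_zero_symm.1 hz, mul_zero]
  have := norm_add_sq_eq_norm_sq_add_norm_sq_of_inner_eq_zero z (b • u) h
  rw [norm_smul, hu, mul_one] at this
  linarith

lemma norm_sq_eq_proj {n : ℕ} {u : Cn n} (hu : ‖u‖ = 1) (y : Cn n) :
    ‖y‖ ^ 2 = ‖y - inner ℂ u y • u‖ ^ 2 + ‖inner ℂ u y‖ ^ 2 := by
  rw [← norm_sq_add_smul hu (inner_sub_proj hu y)]
  simp

lemma norm_sq_anisoDil {n : ℕ} {u : Cn n} (hu : ‖u‖ = 1) (t : ℝ) (y : Cn n) :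
    ‖anisoDil u t y‖ ^ 2 = t ^ 2 * ‖y - inner ℂ u y • u‖ ^ 2 + t ^ 4 * ‖inner ℂ u y‖ ^ 2 := by
  rw [anisoDil_eq, norm_sq_add_smul hu (by rw [inner_smul_right, inner_sub_proj hu, mul_zero])]
  simp only [norm_smul, norm_mul, norm_pow, Complex.norm_real, Real.norm_eq_abs, mul_pow, sq_abs]
  ring

lemma abs_det_anisoDil {n : ℕ} {u : Cn n} (hu : ‖u‖ = 1) {t : ℝ} (ht : 0 < t) :
    |((anisoDil u t).restrictScalars ℝ).det| = t ^ (2 * (n + 1)) := by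
  have h1 : (anisoDil u t : Cn n →ₗ[ℂ] Cn n) = (t : ℂ) • LinearMap.transvection
      (((innerSL ℂ u : Cn n →L[ℂ] ℂ) : Cn n →ₗ[ℂ] ℂ)) (((t : ℂ) - 1) • u) := by
    ext1 y
    simp only [ContinuousLinearMap.coe_coe, anisoDil_apply, LinearMap.smul_apply,
      LinearMap.transvection.apply, innerSL_apply_apply]
    module
  have h2 : (anisoDil u t : Cn n →ₗ[ℂ] Cn n).det = (t : ℂ) ^ (n + 1) := by
    rw [h1, LinearMap.det_smul, LinearMap.transvection.det]
    simp only [ContinuousLinearMap.coe_coe, innerSL_apply_apply, inner_smul_right,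
      inner_self_of_unit hu, finrank_euclideanSpace, Fintype.card_fin]
    ring
  have h3 : ((anisoDil u t).restrictScalars ℝ).det =
      ((anisoDil u t : Cn n →ₗ[ℂ] Cn n).restrictScalars ℝ).det := rfl
  rw [h3, LinearMap.det_restrictScalars, h2, Algebra.norm_complex_eq]
  change |Complex.normSq _| = _
  rw [Complex.normSq_eq_norm_sq, norm_pow, Complex.norm_real, Real.norm_of_nonneg ht.le,
    abs_of_pos (by positivity)]
  ring

lemma anisoDil_injective {n : ℕ} {u : Cn n} (hu : ‖u‖ = 1) {t : ℝ} (ht : 0 < t) :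
    Function.Injective (anisoDil u t) := by
  rw [injective_iff_map_eq_zero]
  intro y hy
  have h := norm_sq_anisoDil hu t y
  rw [hy, norm_zero] at h
  have h1 : 0 ≤ t ^ 2 * ‖y - inner ℂ u y • u‖ ^ 2 := by positivity
  have h2 : 0 ≤ t ^ 4 * ‖inner ℂ u y‖ ^ 2 := by positivity
  have h3 : ‖y - inner ℂ u y • u‖ ^ 2 = 0 := by
    have : t ^ 2 * ‖y - inner ℂ u y • u‖ ^ 2 = 0 := by linarith
    simpa [ht.ne'] using this
  have h4 : ‖inner ℂ u y‖ ^ 2 = 0 := by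
    have : t ^ 4 * ‖inner ℂ u y‖ ^ 2 = 0 := by linarith
    simpa [ht.ne'] using this
  have h5 := norm_sq_eq_proj hu y
  rw [h3, h4] at h5
  simpa using h5

lemma anisoDil_surjective {n : ℕ} {u : Cn n} (hu : ‖u‖ = 1) {t : ℝ} (ht : 0 < t) :
    Function.Surjective (anisoDil u t) :=
  LinearMap.surjective_of_injective (f := (anisoDil u t : Cn n →ₗ[ℂ] Cn n))
    (anisoDil_injective hu ht)

lemma setIntegral_anisoDil_image {n : ℕ} {u : Cn n} (hu : ‖u‖ = 1) {t : ℝ} (ht : 0 < t)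
    (q : Cn n) {s : Set (Cn n)} (hs : MeasurableSet s) (F : Cn n → ℝ) :
    ∫ z in (fun y => q + anisoDil u t y) '' s, F z =
      ∫ y in s, t ^ (2 * (n + 1)) * F (q + anisoDil u t y) := by
  rw [integral_image_eq_integral_abs_det_fderiv_smul volume hs
    (f' := fun _ => (anisoDil u t).restrictScalars ℝ)]
  · simp only [abs_det_anisoDil hu ht, smul_eq_mul]
  · intro x _
    exact (((anisoDil u t).restrictScalars ℝ).hasFDerivAt.const_add q).hasFDerivWithinAt
  · exact fun x _ y _ hxy => anisoDil_injective hu ht (add_left_cancel hxy)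

/-- A bounded sequence in `A²(Ω)` that tends to `0` pointwise is weakly null. -/
lemma weakNull_of_bounded_of_tendsto {n : ℕ} {Ω : Set (Cn n)} (hΩ : IsOpen Ω)
    {g : ℕ → Cn n → ℂ} (hg : ∀ j, InA2 Ω (g j)) {C : ℝ} (hC : ∀ j, a2NormSq Ω (g j) ≤ C)
    (h0 : ∀ w ∈ Ω, Tendsto (fun j => g j w) atTop (𝓝 0)) : WeakNull Ω g := by
  refine ⟨hg, fun f hf => ?_⟩
  have hgm : ∀ j, AEStronglyMeasurable (g j) (volume.restrict Ω) := fun j =>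
    (hg j).1.continuousOn.aestronglyMeasurable hΩ.measurableSet
  have hfm : AEStronglyMeasurable f (volume.restrict Ω) :=
    hf.1.continuousOn.aestronglyMeasurable hΩ.measurableSet
  have hC0 : 0 ≤ C := (integral_nonneg fun _ => by positivity).trans (hC 0)
  rw [Metric.tendsto_atTop']
  intro δ hδ
  set ε := δ / (2 * (C + 1)) with hε
  have hε0 : 0 < ε := by positivity
  set m : ℕ → Cn n → ℝ := fun j z => ‖f z‖ * min ‖g j z‖ (‖f z‖ / ε) with hm
  have hmm : ∀ j, AEStronglyMeasurable (m j) (volume.restrict Ω) := fun j =>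
    hfm.norm.mul ((hgm j).norm.inf 
      (hfm.norm.aemeasurable.div_const ε).aestronglyMeasurable)
  have hbi : Integrable (fun z => ‖f z‖ ^ 2 / ε) (volume.restrict Ω) := hf.2.div_const ε
  have hmb : ∀ j z, ‖m j z‖ ≤ ‖f z‖ ^ 2 / ε := by
    intro j z
    rw [Real.norm_of_nonneg (by positivity)]
    calc ‖f z‖ * min ‖g j z‖ (‖f z‖ / ε) ≤ ‖f z‖ * (‖f z‖ / ε) := by
          gcongr; exact min_le_right _ _
      _ = ‖f z‖ ^ 2 / ε := by ring
  have hmi : ∀ j, Integrable (m j) (volume.restrict Ω) := fun j =>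
    hbi.mono' (hmm j) (ae_of_all _ (hmb j))
  have hlim : Tendsto (fun j => ∫ z in Ω, m j z) atTop (𝓝 (∫ _ in Ω, (0 : ℝ))) := by
    refine tendsto_integral_of_dominated_convergence _ hmm hbi
      (fun j => ae_of_all _ (hmb j)) ?_
    filter_upwards [ae_restrict_mem hΩ.measurableSet] with z hz
    have h1 := (h0 z hz).norm
    rw [norm_zero] at h1
    have h2 := (h1.min (tendsto_const_nhds (x := ‖f z‖ / ε))).const_mul ‖f z‖
    rwa [min_eq_left (by positivity), mul_zero] at h2
  rw [integral_zero] at hlim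
  obtain ⟨J, hJ⟩ := Metric.tendsto_atTop.1 hlim (δ / 2) (by positivity)
  refine ⟨J, fun j hj => ?_⟩
  rw [dist_zero_right]
  have hpt : ∀ z, ‖(starRingEnd ℂ) (f z) * g j z‖ ≤ ε * ‖g j z‖ ^ 2 + m j z := by
    intro z
    rw [norm_mul, RCLike.norm_conj]
    simp only [hm]
    rcases le_total ‖g j z‖ (‖f z‖ / ε) with h | h
    · rw [min_eq_left h]
      nlinarith [sq_nonneg ‖g j z‖]
    · have h3 : ‖f z‖ ≤ ε * ‖g j z‖ := by rwa [div_le_iff₀' hε0] at h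
      have h4 : 0 ≤ ‖f z‖ * min ‖g j z‖ (‖f z‖ / ε) := by positivity
      nlinarith [norm_nonneg (g j z)]
  have hint := (((hg j).2.const_mul ε).add (hmi j))
  have h5 : ‖a2Inner Ω (f := g j) (g := f)‖ ≤ ε * a2NormSq Ω (g j) + ∫ z in Ω, m j z := by
    refine (norm_integral_le_of_norm_le hint (ae_of_all _ hpt)).trans_eq ?_
    simp only [Pi.add_apply]
    rw [integral_add ((hg j).2.const_mul ε) (hmi j), integral_const_mul]
    rfl
  have h6 := hJ j hj.le
  rw [Real.dist_eq, sub_zero] at h6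
  have h7 : ε * a2NormSq Ω (g j) ≤ δ / 2 := by
    calc ε * a2NormSq Ω (g j) ≤ ε * (C + 1) := by gcongr; linarith [hC j]
      _ = δ / 2 := by rw [hε]; field_simp
  linarith [le_abs_self (∫ z in Ω, m j z)]

lemma inA2_of_bounded {n : ℕ} {Ω : Set (Cn n)} (hΩ : IsOpen Ω) (hΩb : Bornology.IsBounded Ω)
    {g : Cn n → ℂ} (hg : DifferentiableOn ℂ g Ω) {B : ℝ} (hB : ∀ w ∈ Ω, ‖g w‖ ≤ B) :
    InA2 Ω g := by
  refine ⟨hg, ?_⟩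
  refine IntegrableOn.of_bound hΩb.measure_lt_top
    ((hg.continuousOn.norm.pow 2).aestronglyMeasurable hΩ.measurableSet) (B ^ 2) ?_
  filter_upwards [ae_restrict_mem hΩ.measurableSet] with w hw
  rw [norm_pow, norm_norm]
  gcongr
  exact hB w hw

/-- A normalized holomorphic function concentrating at the boundary point `p` with inner unit
normal `u` as `η → 0`. -/
def peakFn {n : ℕ} (u p : Cn n) (η : ℝ) (w : Cn n) : ℂ :=
  ((η : ℂ) / ((η : ℂ) ^ 2 + inner ℂ u (w - p))) ^ (n + 1)

lemma sq_le_norm_sq_add {η : ℝ} {z : ℂ} (hz : 0 ≤ z.re) : η ^ 2 ≤ ‖(η : ℂ) ^ 2 + z‖ := by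
  refine le_trans ?_ (Complex.re_le_norm _)
  rw [← Complex.ofReal_pow, Complex.add_re, Complex.ofReal_re]
  linarith

lemma norm_peakFn_le {n : ℕ} {u p : Cn n} {η : ℝ} (hη : 0 < η) {w : Cn n}
    (hw : 0 ≤ (inner ℂ u (w - p)).re) : ‖peakFn u p η w‖ ≤ (1 / η) ^ (n + 1) := by
  rw [peakFn, norm_pow, norm_div, Complex.norm_real, Real.norm_of_nonneg hη.le]
  refine pow_le_pow_left₀ (by positivity) ?_ _
  calc η / ‖(η : ℂ) ^ 2 + inner ℂ u (w - p)‖ ≤ η / η ^ 2 := by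
        gcongr
        exact sq_le_norm_sq_add hw
    _ = 1 / η := by field_simp

lemma differentiableOn_peakFn {n : ℕ} {u p : Cn n} {η : ℝ} (hη : 0 < η) {Ω : Set (Cn n)}
    (hΩ : ∀ w ∈ Ω, 0 ≤ (inner ℂ u (w - p)).re) : DifferentiableOn ℂ (peakFn u p η) Ω := by
  have h1 : DifferentiableOn ℂ (fun w => (η : ℂ) ^ 2 + innerSL ℂ u (w - p)) Ω := by fun_prop
  have hne : ∀ w ∈ Ω, (η : ℂ) ^ 2 + innerSL ℂ u (w - p) ≠ 0 := by
    intro w hw h0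
    have := sq_le_norm_sq_add (η := η) (hΩ w hw)
    rw [innerSL_apply_apply] at h0
    rw [h0, norm_zero] at this
    have : 0 < η ^ 2 := by positivity
    linarith
  exact DifferentiableOn.fun_pow ((h1.fun_inv hne).const_mul _) _

lemma tendsto_peakFn {n : ℕ} {u p w : Cn n} (hw : inner ℂ u (w - p) ≠ 0) :
    Tendsto (fun η : ℝ => peakFn u p η w) (𝓝 0) (𝓝 0) := by
  have h : ContinuousAt (fun η : ℝ => peakFn u p η w) 0 := by
    unfold peakFn
    refine ContinuousAt.pow (ContinuousAt.div (by fun_prop) (by fun_prop) ?_) _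
    simpa using hw
  have h2 := h.tendsto
  simpa [peakFn] using h2

lemma one_add_norm_le {n : ℕ} {u : Cn n} (hu : ‖u‖ = 1) {k : ℝ} (hk : 0 < k) {y : Cn n}
    (hy : k * ‖y - inner ℂ u y • u‖ ^ 2 ≤ (inner ℂ u y).re) :
    1 + ‖y‖ ≤ (3 + 1 / k) * ‖1 + inner ℂ u y‖ := by
  set b : ℂ := inner ℂ u y with hb
  set x := ‖y - b • u‖ with hx
  have hre : 0 ≤ b.re := le_trans (by positivity) hy
  have h1 : 1 + b.re ≤ ‖1 + b‖ := by
    refine le_trans ?_ (Complex.re_le_norm _)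
    simp
  have h2 : ‖b‖ ≤ ‖1 + b‖ := by
    refine le_of_sq_le_sq ?_ (norm_nonneg _)
    rw [← Complex.normSq_eq_norm_sq, ← Complex.normSq_eq_norm_sq, Complex.normSq_apply,
      Complex.normSq_apply]
    simp only [Complex.add_re, Complex.one_re, Complex.add_im, Complex.one_im, zero_add]
    nlinarith
  have h3 : ‖y‖ ≤ x + ‖b‖ := by
    calc ‖y‖ = ‖(y - b • u) + b • u‖ := by simp
      _ ≤ x + ‖b • u‖ := norm_add_le _ _
      _ = x + ‖b‖ := by rw [norm_smul, hu, mul_one]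
  have h4 : x ^ 2 ≤ 1 / k * ‖1 + b‖ := by
    rw [div_mul_eq_mul_div, one_mul, le_div_iff₀ hk]
    linarith
  nlinarith [sq_nonneg (x - 1)]

lemma integrable_one_add_norm_rpow (n : ℕ) :
    Integrable (fun y : Cn n => (1 + ‖y‖) ^ (-((2 * (n + 1) : ℕ) : ℝ))) volume := by
  refine integrable_one_add_norm ?_
  rw [finrank_real_of_complex, finrank_euclideanSpace, Fintype.card_fin]
  push_cast
  linarith

/-- The functions `peakFn u p η` are uniformly bounded in `A²(Ω)` if `Ω` is contained in a
paraboloid touching the hyperplane orthogonal to `u` at `p`. -/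
lemma exists_a2NormSq_peakFn_le {n : ℕ} {Ω : Set (Cn n)} (hΩ : IsOpen Ω) {u p : Cn n}
    (hu : ‖u‖ = 1) {k : ℝ} (hk : 0 < k)
    (hΩk : ∀ w ∈ Ω, k * ‖w - p‖ ^ 2 ≤ (inner ℂ u (w - p)).re) :
    ∃ C, ∀ η > 0, a2NormSq Ω (peakFn u p η) ≤ C := by
  set K := 3 + 1 / k with hK
  have hK0 : 0 < K := by positivity
  set G : Cn n → ℝ := fun y => K ^ (2 * (n + 1)) * (1 + ‖y‖) ^ (-((2 * (n + 1) : ℕ) : ℝ)) with hG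
  have hGi : Integrable G volume := (integrable_one_add_norm_rpow n).const_mul _
  refine ⟨∫ y, G y, fun η hη => ?_⟩
  set f : Cn n → Cn n := fun y => p + anisoDil u η y with hf
  have hfc : Continuous f := by fun_prop
  have hfs : Function.Surjective f := fun z => by
    obtain ⟨y, hy⟩ := anisoDil_surjective hu hη (z - p)
    exact ⟨y, by simp [hf, hy]⟩
  have hm : MeasurableSet (f ⁻¹' Ω) := (hΩ.preimage hfc).measurableSet
  rw [a2NormSq, ← image_preimage_eq Ω hfs, setIntegral_anisoDil_image hu hη p hm]
  refine (integral_mono_of_nonneg (g := G) (ae_of_all _ fun y => by positivity)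
    hGi.integrableOn ?_).trans
    (setIntegral_le_integral hGi (ae_of_all _ fun y => by positivity))
  filter_upwards [ae_restrict_mem hm] with y hy
  have h1 := hΩk _ hy
  simp only [hf, add_sub_cancel_left] at h1
  rw [norm_sq_anisoDil hu, inner_anisoDil hu, ← Complex.ofReal_pow, Complex.re_ofReal_mul] at h1
  have h2 : k * ‖y - inner ℂ u y • u‖ ^ 2 ≤ (inner ℂ u y).re := by
    have h3 : 0 ≤ k * (η ^ 4 * ‖inner ℂ u y‖ ^ 2) := by positivity
    refine le_of_mul_le_mul_left ?_ (pow_pos hη 2)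
    linarith
  have h4 := one_add_norm_le hu hk h2
  have hpos : 0 < ‖1 + inner ℂ u y‖ := by
    have : 0 < 1 + ‖y‖ := by positivity
    exact pos_of_mul_pos_right (this.trans_le h4) hK0.le
  have h5 : η ^ (2 * (n + 1)) * ‖peakFn u p η (p + anisoDil u η y)‖ ^ 2 =
      (1 / ‖1 + inner ℂ u y‖) ^ (2 * (n + 1)) := by
    rw [peakFn, add_sub_cancel_left, inner_anisoDil hu]
    have : (η : ℂ) ^ 2 + (η : ℂ) ^ 2 * inner ℂ u y = (η : ℂ) ^ 2 * (1 + inner ℂ u y) := by ring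
    rw [this, norm_pow, norm_div, norm_mul, norm_pow, Complex.norm_real, Real.norm_of_nonneg hη.le,
      ← pow_mul, mul_comm (n + 1) 2, ← mul_pow]
    congr 1
    field_simp
  refine h5.trans_le ?_
  simp only [hG]
  rw [Real.rpow_neg (by positivity), Real.rpow_natCast, ← inv_pow, ← mul_pow]
  gcongr
  rw [div_le_iff₀ hpos, mul_comm K, mul_assoc, ← div_eq_inv_mul, le_div_iff₀ (by positivity)]
  linarith

/-- A lower bound for the `A²` norm of `peakFn u p η ∘ φ` on a small anisotropic region. -/
lemma le_a2NormSq_peakFn_comp {n : ℕ} {Ω : Set (Cn n)} {u p : Cn n} {η : ℝ}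
    (hη : 0 < η) {φ : Cn n → Cn n} (hφ : ∀ z ∈ Ω, 0 ≤ (inner ℂ u (φ z - p)).re)
    (hint : InA2 Ω (fun z => peakFn u p η (φ z)))
    {v q : Cn n} (hv : ‖v‖ = 1) {r C : ℝ} (hC : 0 ≤ C)
    (hr : ∀ y ∈ ball v r, q + anisoDil v η y ∈ Ω ∧
      ‖inner ℂ u (φ (q + anisoDil v η y) - p)‖ ≤ C * η ^ 2) :
    volume.real (ball v r) * (1 / (1 + C)) ^ (2 * (n + 1)) ≤
      a2NormSq Ω (fun z => peakFn u p η (φ z)) := by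
  set f : Cn n → Cn n := fun y => q + anisoDil v η y with hf
  have hsub : f '' ball v r ⊆ Ω := by
    rintro _ ⟨y, hy, rfl⟩
    exact (hr y hy).1
  have h1 : ∫ z in f '' ball v r, ‖peakFn u p η (φ z)‖ ^ 2 ≤
      a2NormSq Ω (fun z => peakFn u p η (φ z)) :=
    setIntegral_mono_set hint.2 (ae_of_all _ fun z => by positivity) hsub.eventuallyLE
  refine le_trans ?_ h1
  have hinj : InjOn f (ball v r) := fun x _ y _ hxy =>
    anisoDil_injective hv hη (add_left_cancel hxy)
  have hi2 := hint.2.mono_set hsub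
  have hfd : ∀ x ∈ ball v r, HasFDerivWithinAt f ((anisoDil v η).restrictScalars ℝ)
      (ball v r) x := fun x _ =>
    (((anisoDil v η).restrictScalars ℝ).hasFDerivAt.const_add q).hasFDerivWithinAt
  rw [integrableOn_image_iff_integrableOn_abs_det_fderiv_smul volume measurableSet_ball
    hfd hinj] at hi2
  simp only [abs_det_anisoDil hv hη, smul_eq_mul] at hi2
  rw [setIntegral_anisoDil_image hv hη q measurableSet_ball, mul_comm]
  refine setIntegral_ge_of_const_le_real measurableSet_ball measure_ball_lt_top.ne ?_ hi2
  intro y hy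
  obtain ⟨hyΩ, hyC⟩ := hr y hy
  have h2 := sq_le_norm_sq_add (η := η) (hφ _ hyΩ)
  have h3 : ‖(η : ℂ) ^ 2 + inner ℂ u (φ (q + anisoDil v η y) - p)‖ ≤ (1 + C) * η ^ 2 := by
    refine (norm_add_le _ _).trans ?_
    rw [norm_pow, Complex.norm_real, Real.norm_of_nonneg hη.le]
    linarith
  have h4 : 0 < ‖(η : ℂ) ^ 2 + inner ℂ u (φ (q + anisoDil v η y) - p)‖ :=
    (pow_pos hη 2).trans_le h2
  rw [peakFn, norm_pow, norm_div, Complex.norm_real, Real.norm_of_nonneg hη.le,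
      ← pow_mul, mul_comm (n + 1) 2, ← mul_pow]
  gcongr
  rw [← mul_div_assoc, div_le_div_iff₀ (by positivity) h4]
  linarith

/-- A complex functional whose real part is nonnegative on a half space is a multiple of the inner
product with the normal. -/
lemma eq_inner_mul_of_re_nonneg {n : ℕ} {v : Cn n} (hv : ‖v‖ = 1) (L : Cn n →L[ℂ] ℂ)
    (hLpos : ∀ h, 0 < (inner ℂ v h).re → 0 ≤ (L h).re) (h : Cn n) :
    L h = inner ℂ v h * L v := by
  have hLker : ∀ h, inner ℂ v h = 0 → L h = 0 := by
    intro h hh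
    have h1 : ∀ ε > 0, ‖L h‖ ^ 2 ≤ ε * (L v).re := by
      intro ε hε
      have h2 := hLpos (-(starRingEnd ℂ (L h)) • h + (ε : ℂ) • v) (by
        rw [inner_add_right, inner_smul_right, inner_smul_right, hh, inner_self_of_unit hv]
        simpa using hε)
      rw [map_add, map_smul, map_smul, smul_eq_mul, smul_eq_mul, neg_mul, Complex.conj_mul',
        Complex.add_re, Complex.re_ofReal_mul, Complex.neg_re, ← Complex.ofReal_pow,
        Complex.ofReal_re] at h2
      linarith
    have hlim : Tendsto (fun ε : ℝ => ε * (L v).re) (𝓝[>] 0) (𝓝 0) := by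
      have : ContinuousAt (fun ε : ℝ => ε * (L v).re) 0 := by fun_prop
      simpa using this.tendsto.mono_left nhdsWithin_le_nhds
    have h3 : ‖L h‖ ^ 2 ≤ 0 :=
      ge_of_tendsto hlim (by filter_upwards [self_mem_nhdsWithin] with ε hε using h1 ε hε)
    simpa using le_antisymm h3 (by positivity)
  have h1 := hLker _ (inner_sub_proj hv h)
  rw [map_sub, map_smul, smul_eq_mul, sub_eq_zero] at h1
  exact h1

lemma anisoDil_ball_bounds {n : ℕ} {v : Cn n} (hv : ‖v‖ = 1) {r : ℝ} (hr1 : r ≤ 1 / 2) (η : ℝ)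
    {y : Cn n} (hy : y ∈ ball v r) :
    ‖inner ℂ v y‖ ≤ 2 ∧ 1 / 2 ≤ (inner ℂ v y).re ∧
      ‖anisoDil v η y‖ ^ 2 ≤ η ^ 2 * (r ^ 2 + 4 * η ^ 2) := by
  obtain ⟨z, rfl⟩ : ∃ z, y = v + z := ⟨y - v, by abel⟩
  have hz : ‖z‖ < r := by simpa using hy
  have hb : inner ℂ v (v + z) = 1 + inner ℂ v z := by
    rw [inner_add_right, inner_self_of_unit hv]
  have hbz : ‖inner ℂ v z‖ ≤ ‖z‖ := by
    simpa [hv] using norm_inner_le_norm (𝕜 := ℂ) v z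
  have hproj : v + z - inner ℂ v (v + z) • v = z - inner ℂ v z • v := by
    rw [hb]
    module
  have hb2 : ‖inner ℂ v (v + z)‖ ≤ 2 := by
    rw [hb]
    refine (norm_add_le _ _).trans ?_
    rw [norm_one]
    linarith
  have hbre : 1 / 2 ≤ (inner ℂ v (v + z)).re := by
    rw [hb, Complex.add_re, Complex.one_re]
    have := (abs_le.1 (Complex.abs_re_le_norm (inner ℂ v z))).1
    linarith
  have hT : ‖anisoDil v η (v + z)‖ ^ 2 ≤ η ^ 2 * (r ^ 2 + 4 * η ^ 2) := by
    rw [norm_sq_anisoDil hv, hproj]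
    have h1 := norm_sq_eq_proj hv z
    have h2 : ‖z‖ ^ 2 ≤ r ^ 2 := by gcongr
    have h3 : ‖inner ℂ v (v + z)‖ ^ 2 ≤ 2 ^ 2 := by gcongr
    have h4 : ‖z - inner ℂ v z • v‖ ^ 2 ≤ r ^ 2 := by
      nlinarith [sq_nonneg ‖inner ℂ v z‖]
    calc _ ≤ η ^ 2 * r ^ 2 + η ^ 4 * 2 ^ 2 := by gcongr
      _ = _ := by ring
  exact ⟨hb2, hbre, hT⟩

/-- If `ψ` has nonnegative real part on `{ρ < 0}`, then its differential at a boundary point has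
nonnegative real part in inward directions. -/
lemma re_fderiv_nonneg_of_re_nonneg {n : ℕ} {Ω : Set (Cn n)} {ρ : Cn n → ℝ} {ψ : Cn n → ℂ}
    {q v : Cn n} {L : Cn n →L[ℂ] ℂ} {R₁ R₂ a M M₂ : ℝ} (hR₁ : 0 < R₁) (hR₂ : 0 < R₂) (ha : 0 < a)
    (hΩ : ∀ z, ρ z < 0 → z ∈ Ω)
    (hup : ∀ h, ‖h‖ < R₁ → ρ (q + h) ≤ -(a * (inner ℂ v h).re) + M * ‖h‖ ^ 2)
    (hψup : ∀ h, ‖h‖ < R₂ → ‖ψ (q + h) - L h‖ ≤ M₂ * ‖h‖ ^ 2)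
    (hψΩ : ∀ z ∈ Ω, 0 ≤ (ψ z).re) (h : Cn n) (hh : 0 < (inner ℂ v h).re) : 0 ≤ (L h).re := by
  have hlim : Tendsto (fun t : ℝ => -(M₂ * t * ‖h‖ ^ 2)) (𝓝[>] 0) (𝓝 0) := by
    have : ContinuousAt (fun t : ℝ => -(M₂ * t * ‖h‖ ^ 2)) 0 := by fun_prop
    simpa using this.tendsto.mono_left nhdsWithin_le_nhds
  refine le_of_tendsto hlim ?_
  have e1 : ∀ᶠ t : ℝ in 𝓝 0, M * t * ‖h‖ ^ 2 < a * (inner ℂ v h).re := by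
    have hc : ContinuousAt (fun t : ℝ => M * t * ‖h‖ ^ 2) 0 := by fun_prop
    refine hc.eventually_lt continuousAt_const ?_
    simpa using mul_pos ha hh
  have e2 : ∀ᶠ t : ℝ in 𝓝 0, ‖t • h‖ < min R₁ R₂ := by
    have hc : ContinuousAt (fun t : ℝ => ‖t • h‖) 0 := by fun_prop
    refine hc.eventually_lt continuousAt_const ?_
    simpa using ⟨hR₁, hR₂⟩
  filter_upwards [self_mem_nhdsWithin, nhdsWithin_le_nhds e1, nhdsWithin_le_nhds e2]
    with t ht h1 h2
  have ht : 0 < t := ht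
  have hth : t • h = (t : ℂ) • h := (Complex.coe_smul t h).symm
  have hnorm : ‖t • h‖ = t * ‖h‖ := by rw [norm_smul, Real.norm_of_nonneg ht.le]
  have h3 := hup (t • h) (h2.trans_le (min_le_left _ _))
  have h4 := hψup (t • h) (h2.trans_le (min_le_right _ _))
  rw [hnorm] at h3 h4
  have h5 : (inner ℂ v (t • h)).re = t * (inner ℂ v h).re := by
    rw [hth, inner_smul_right, Complex.re_ofReal_mul]
  have h6 : (L (t • h)).re = t * (L h).re := by
    rw [hth, map_smul, smul_eq_mul, Complex.re_ofReal_mul]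
  have h7 : ρ (q + t • h) < 0 := by
    rw [h5] at h3
    nlinarith
  have h8 := hψΩ _ (hΩ _ h7)
  have h9 := (Complex.re_le_norm _).trans h4
  rw [Complex.sub_re, h6] at h9
  refine le_of_mul_le_mul_left ?_ ht
  nlinarith

/-- Hopf-type lemma: a holomorphic function with nonnegative real part on `Ω`, vanishing at a smooth
boundary point `q`, is `O(η ^ 2)` on anisotropic regions of size `η` at `q` contained in `Ω`. -/
lemma exists_anisoDil_bound {n : ℕ} {Ω : Set (Cn n)} {ρ : Cn n → ℝ} (hρ : ContDiff ℝ 2 ρ)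
    (hΩ : ∀ z, ρ z < 0 → z ∈ Ω) {q : Cn n} (hq : ρ q = 0) (hdq : fderiv ℝ ρ q ≠ 0)
    {ψ : Cn n → ℂ} {U : Set (Cn n)} (hU : U ∈ 𝓝 q) (hψ : DifferentiableOn ℂ ψ U)
    (hψq : ψ q = 0) (hψΩ : ∀ z ∈ Ω, 0 ≤ (ψ z).re) :
    ∃ v : Cn n, ‖v‖ = 1 ∧ ∃ r > 0, ∃ η₀ > 0, ∃ C ≥ 0, ∀ η, 0 < η → η < η₀ → ∀ y ∈ ball v r,
      q + anisoDil v η y ∈ Ω ∧ ‖ψ (q + anisoDil v η y)‖ ≤ C * η ^ 2 := by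
  obtain ⟨v, hv, a, ha, hDv⟩ := exists_unit_eq_neg_re_inner (fderiv ℝ ρ q) hdq
  obtain ⟨R₁, hR₁, htay⟩ := hρ.second_order_bound q one_pos
  obtain ⟨M₂, hM₂, R₂, hR₂, hψtay⟩ := hψ.exists_quadratic_remainder hU
  set H := fderiv ℝ (fderiv ℝ ρ) q with hH
  set L := fderiv ℂ ψ q with hL
  obtain ⟨M, hM⟩ : ∃ M, M = ‖H‖ + 1 := ⟨_, rfl⟩
  have hM0 : 0 < M := by rw [hM]; positivity
  have hup : ∀ h, ‖h‖ < R₁ → ρ (q + h) ≤ -(a * (inner ℂ v h).re) + M * ‖h‖ ^ 2 := by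
    intro h hh
    have h1 := (abs_le.1 (htay h hh)).2
    have h2 : H h h ≤ ‖H‖ * ‖h‖ * ‖h‖ := (le_abs_self _).trans (H.le_opNorm₂ h h)
    rw [hq, hDv] at h1
    have h3 : 0 ≤ ‖H‖ * ‖h‖ ^ 2 := by positivity
    rw [hM]
    nlinarith
  have hψup : ∀ h, ‖h‖ < R₂ → ‖ψ (q + h) - L h‖ ≤ M₂ * ‖h‖ ^ 2 := by
    intro h hh
    simpa [hψq] using hψtay h hh
  have hLeq := eq_inner_mul_of_re_nonneg hv L
    (re_fderiv_nonneg_of_re_nonneg hR₁ hR₂ ha hΩ hup hψup hψΩ)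
  set r := min (1 / 2) (a / (4 * M)) with hr
  have hr0 : 0 < r := by positivity
  set η₀ := min (min 1 (a / (32 * M))) (min (R₁ / 3) (R₂ / 3)) with hη₀
  refine ⟨v, hv, r, hr0, η₀, by positivity, 2 * ‖L v‖ + M₂ * 9, by positivity, ?_⟩
  intro η hη hηη₀ y hy
  have hr1 : r ≤ 1 / 2 := min_le_left _ _
  have hr2 : M * r ≤ a / 4 := by
    calc M * r ≤ M * (a / (4 * M)) := by gcongr; exact min_le_right _ _
      _ = a / 4 := by field_simp
  have hη1 : η ≤ 1 := (hηη₀.trans_le ((min_le_left _ _).trans (min_le_left _ _))).le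
  have hη2 : M * η < a / 32 := by
    calc M * η < M * (a / (32 * M)) := by
          gcongr
          exact hηη₀.trans_le ((min_le_left _ _).trans (min_le_right _ _))
      _ = a / 32 := by field_simp
  have hη3 : η < R₁ / 3 := hηη₀.trans_le ((min_le_right _ _).trans (min_le_left _ _))
  have hη4 : η < R₂ / 3 := hηη₀.trans_le ((min_le_right _ _).trans (min_le_right _ _))
  obtain ⟨hb2, hbre, hT⟩ := anisoDil_ball_bounds hv hr1 η hy
  have hT9 : ‖anisoDil v η y‖ ^ 2 ≤ 9 * η ^ 2 := by
    refine hT.trans ?_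
    have : r ^ 2 + 4 * η ^ 2 ≤ 9 := by nlinarith
    nlinarith [sq_nonneg η]
  have hT3 : ‖anisoDil v η y‖ ≤ 3 * η := by
    refine le_of_sq_le_sq ?_ (by positivity)
    linarith
  constructor
  · refine hΩ _ ((hup _ (by linarith)).trans_lt ?_)
    rw [inner_anisoDil hv, ← Complex.ofReal_pow, Complex.re_ofReal_mul]
    have h1 : M * (r ^ 2 + 4 * η ^ 2) < a / 2 := by
      have h2 : M * r * r ≤ a / 4 * (1 / 2) := by gcongr
      have h3 : M * η * η ≤ a / 32 * 1 := by gcongr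
      nlinarith
    have hη20 : 0 < η ^ 2 := by positivity
    have h4 : M * ‖anisoDil v η y‖ ^ 2 < η ^ 2 * (a / 2) := by
      calc _ ≤ M * (η ^ 2 * (r ^ 2 + 4 * η ^ 2)) := by gcongr
        _ = η ^ 2 * (M * (r ^ 2 + 4 * η ^ 2)) := by ring
        _ < _ := by gcongr
    have h5 : η ^ 2 * (a / 2) ≤ a * (η ^ 2 * (inner ℂ v y).re) := by
      have := mul_le_mul_of_nonneg_left hbre (mul_pos ha hη20).le
      linarith
    linarith
  · have h1 := hψup (anisoDil v η y) (by linarith)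
    have h2 : ‖L (anisoDil v η y)‖ ≤ 2 * ‖L v‖ * η ^ 2 := by
      rw [hLeq, inner_anisoDil hv, norm_mul, norm_mul, norm_pow, Complex.norm_real,
        Real.norm_of_nonneg hη.le]
      calc _ ≤ η ^ 2 * 2 * ‖L v‖ := by gcongr
        _ = _ := by ring
    have h3 : ‖ψ (q + anisoDil v η y)‖ ≤
        ‖ψ (q + anisoDil v η y) - L (anisoDil v η y)‖ +
          ‖L (anisoDil v η y)‖ := by
      simpa using norm_add_le (ψ (q + anisoDil v η y) - L (anisoDil v η y))
        (L (anisoDil v η y))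
    have h4 : M₂ * ‖anisoDil v η y‖ ^ 2 ≤ M₂ * (9 * η ^ 2) := by gcongr
    linarith

/-- for a smoothly bounded strongly convex domain and `φ` holomorphic
near the closure, compactness of `C_φ` forces `J_φ = 0` at every point of
`∂Ω ∩ ∂(φ(closure Ω))`. -/
theorem stmt10 {n : ℕ} (Ω : Set (Cn n)) (hΩo : IsOpen Ω) (hΩc : Convex ℝ Ω)
    (hΩb : Bornology.IsBounded Ω) (hΩne : Ω.Nonempty)
    (ρ : Cn n → ℝ) (hρ : IsDefiningFn Ω ⊤ ρ)
    (hstrong : ∀ p ∈ frontier Ω, ∀ v : Cn n, v ≠ 0 → fderiv ℝ ρ p v = 0 →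
      0 < fderiv ℝ (fun q => fderiv ℝ ρ q v) p v)
    (φ : Cn n → Cn n) (U : Set (Cn n)) (hU : IsOpen U) (hUc : closure Ω ⊆ U)
    (hφU : DifferentiableOn ℂ φ U) (hφm : Set.MapsTo φ Ω Ω)
    (hcomp : CompactCompOp Ω φ)
    (p : Cn n) (hp : p ∈ frontier Ω ∩ frontier (φ '' closure Ω)) :
    Jdet φ p = 0 := by
  exfalso
  obtain ⟨hρs, hΩρ, hfr, hdρ⟩ := hρ
  obtain ⟨hpΩ, hpφ⟩ := hp
  have hρ2 : ContDiff ℝ 2 ρ := hρs.of_le (WithTop.coe_le_coe.2 (le_top : (2 : ℕ∞) ≤ ⊤))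
  have hφc : ContinuousOn φ (closure Ω) := hφU.continuousOn.mono hUc
  have hcl : IsCompact (closure Ω) := hΩb.isCompact_closure
  obtain ⟨q, hqcl, rfl⟩ : p ∈ φ '' closure Ω :=
    (hcl.image_of_continuousOn hφc).isClosed.frontier_subset hpφ
  have hqΩ : q ∈ frontier Ω := by
    rw [hΩo.frontier_eq] at hpΩ ⊢
    exact ⟨hqcl, fun h => hpΩ.2 (hφm h)⟩
  have hp0 : ρ (φ q) = 0 := by
    rw [hfr] at hpΩ
    exact hpΩ
  have hq0 : ρ q = 0 := by
    rw [hfr] at hqΩ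
    exact hqΩ
  have hneg : ∀ z ∈ Ω, ρ z < 0 := fun z hz => by
    rw [hΩρ] at hz
    exact hz
  have hΩρ' : ∀ z, ρ z < 0 → z ∈ Ω := fun z hz => by
    rw [hΩρ]
    exact hz
  have hd2 : DifferentiableAt ℝ (fderiv ℝ ρ) (φ q) :=
    (hρ2.fderiv_right (m := 1) (by norm_num)).differentiable (by norm_num) _
  obtain ⟨k, hk, hkΩ⟩ := hΩc.exists_quadratic_support hΩo hΩb hρ2 hneg
    (frontier_subset_closure hpΩ) hp0 fun v hv hv0 => by
      have := hstrong _ hpΩ v hv hv0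
      simpa [fderiv_clm_apply hd2 (differentiableAt_const v)] using this
  obtain ⟨u, hu, a, ha, hDu⟩ := exists_unit_eq_neg_re_inner (fderiv ℝ ρ (φ q)) (hdρ _ hpΩ)
  have hka : 0 < k / a := by positivity
  have hpar : ∀ w ∈ Ω, k / a * ‖w - φ q‖ ^ 2 ≤ (inner ℂ u (w - φ q)).re := fun w hw => by
    have h := hkΩ w hw
    rw [hDu, neg_neg] at h
    rw [div_mul_eq_mul_div, div_le_iff₀' ha]
    exact h
  have hpos : ∀ w ∈ Ω, 0 < (inner ℂ u (w - φ q)).re := fun w hw => by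
    have hne : w - φ q ≠ 0 := sub_ne_zero.2 fun h => by
      rw [hΩo.frontier_eq, ← h] at hpΩ
      exact hpΩ.2 hw
    have : 0 < ‖w - φ q‖ := norm_pos_iff.2 hne
    exact lt_of_lt_of_le (by positivity) (hpar w hw)
  have hnn : ∀ w ∈ Ω, 0 ≤ (inner ℂ u (w - φ q)).re := fun w hw => (hpos w hw).le
  obtain ⟨C, hC⟩ := exists_a2NormSq_peakFn_le hΩo hu hka hpar
  have hη : ∀ j : ℕ, (0 : ℝ) < 1 / ((j : ℝ) + 1) := fun j => by positivity
  have hlim : Tendsto (fun j : ℕ => 1 / ((j : ℝ) + 1)) atTop (𝓝 0) :=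
    tendsto_one_div_add_atTop_nhds_zero_nat
  have hin : ∀ η : ℝ, 0 < η → InA2 Ω (peakFn u (φ q) η) := fun η hη =>
    inA2_of_bounded hΩo hΩb (differentiableOn_peakFn hη hnn)
      fun w hw => norm_peakFn_le hη (hnn w hw)
  have hinφ : ∀ η : ℝ, 0 < η → InA2 Ω (fun z => peakFn u (φ q) η (φ z)) := fun η hη =>
    inA2_of_bounded hΩo hΩb
      ((differentiableOn_peakFn hη hnn).comp (hφU.mono (subset_closure.trans hUc)) hφm)
      fun w hw => norm_peakFn_le hη (hnn _ (hφm hw))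
  have hweak : WeakNull Ω (fun j : ℕ => peakFn u (φ q) (1 / ((j : ℝ) + 1))) :=
    weakNull_of_bounded_of_tendsto hΩo (fun j => hin _ (hη j)) (fun j => hC _ (hη j))
      fun w hw => (tendsto_peakFn fun h => by simpa [h] using hpos w hw).comp hlim
  obtain ⟨v, hv, r, hr, η₀, hη₀, B, hB, hbound⟩ := exists_anisoDil_bound hρ2 hΩρ' hq0 (hdρ q hqΩ)
    (ψ := fun z => inner ℂ u (φ z - φ q)) (hU.mem_nhds (hUc hqcl))
    ((innerSL ℂ u).differentiable.comp_differentiableOn (hφU.sub_const _)) (by simp)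
    fun z hz => hnn _ (hφm hz)
  have hvol : 0 < volume.real (ball v r) :=
    ENNReal.toReal_pos (measure_ball_pos _ _ hr).ne' measure_ball_lt_top.ne
  have hc : 0 < volume.real (ball v r) * (1 / (1 + B)) ^ (2 * (n + 1)) := by positivity
  refine hc.not_ge (ge_of_tendsto (hcomp _ hweak) ?_)
  filter_upwards [hlim.eventually_lt_const hη₀] with j hj
  exact le_a2NormSq_peakFn_comp (hη j) (fun z hz => hnn _ (hφm hz)) (hinφ _ (hη j)) hv hB
    fun y hy => hbound _ (hη j) hj y hy
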